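/- Invariance of the Laplace distribution under the Anděl AR(1) scheme (equation (10)). Let λ>0 and φ₁ with 0<|φ₁|<1, and let f_λ(x) = (λ/2)·exp(−λ|x|) be the Laplace density. Then for every x∈ℝ, φ₁² · (1/|φ₁|)·f_λ(x/φ₁) + (1−φ₁²) · ∫_ℝ (1/|φ₁|)·f_λ((x−u)/φ₁)·f_λ(u) du = f_λ(x); that is, if β ~ Laplace(λ) and β' equals φ₁β with probability φ₁² and φ₁β+η with probability 1−φ₁², where η ~ Laplace(λ) is independent of β, then β' ~ Laplace(λ). -/

import Mathlib

open MeasureTheory Real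

/-- Laplace density with rate `lam`. -/
noncomputable def laplacePdf (lam x : ℝ) : ℝ := (lam / 2) * Real.exp (-(lam * |x|))

lemma integral_exp_neg_abs_conv_of_nonneg {a b x : ℝ} (hb : 0 < b) (hab : b < a) (hx : 0 ≤ x) :
    ∫ u : ℝ, exp (-(a * |x - u|)) * exp (-(b * |u|)) =
      2 * (a * exp (-(b * x)) - b * exp (-(a * x))) / (a ^ 2 - b ^ 2) := by
  have hsum : 0 < a + b := by linarith
  have hdiff : 0 < a - b := by linarith
  set f : ℝ → ℝ := fun u => exp (-(a * |x - u|)) * exp (-(b * |u|)) with hf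
  have hleft : Set.EqOn (fun u => exp (-(a * x)) * exp ((a + b) * u)) f (Set.Iic 0) := by
    intro u (hu : u ≤ 0)
    simp only [hf]
    rw [abs_of_nonneg (by linarith : 0 ≤ x - u), abs_of_nonpos hu, ← exp_add, ← exp_add]
    ring_nf
  have hmid : Set.EqOn (fun u => exp (-(a * x)) * exp ((a - b) * u)) f (Set.uIcc 0 x) := by
    intro u hu
    rw [Set.uIcc_of_le hx] at hu
    simp only [hf]
    rw [abs_of_nonneg (by linarith [hu.2] : 0 ≤ x - u), abs_of_nonneg hu.1, ← exp_add, ← exp_add]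
    ring_nf
  have hright : Set.EqOn (fun u => exp (a * x) * exp (-(a + b) * u)) f (Set.Ioi x) := by
    intro u (hu : x < u)
    simp only [hf]
    rw [abs_of_neg (by linarith : x - u < 0), abs_of_nonneg (by linarith), ← exp_add, ← exp_add]
    ring_nf
  have hcont : Continuous f := by fun_prop
  have ileft : IntegrableOn f (Set.Iic 0) :=
    IntegrableOn.congr_fun ((integrableOn_exp_mul_Iic hsum 0).const_mul _) hleft measurableSet_Iic
  have iright : IntegrableOn f (Set.Ioi x) :=
    IntegrableOn.congr_fun ((integrableOn_exp_mul_Ioi (neg_lt_zero.2 hsum) x).const_mul _) hright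
      measurableSet_Ioi
  have imid : IntervalIntegrable f volume 0 x := hcont.intervalIntegrable _ _
  have ipos : IntegrableOn f (Set.Ioi 0) := by
    rw [← Set.Ioc_union_Ioi_eq_Ioi hx]
    exact ((intervalIntegrable_iff_integrableOn_Ioc_of_le hx).1 imid).union iright
  rw [← intervalIntegral.integral_Iic_add_Ioi ileft ipos,
    ← intervalIntegral.integral_interval_add_Ioi ipos iright,
    ← setIntegral_congr_fun measurableSet_Iic hleft,
    ← setIntegral_congr_fun measurableSet_Ioi hright,
    ← intervalIntegral.integral_congr hmid,
    integral_const_mul, integral_const_mul, intervalIntegral.integral_const_mul,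
    integral_exp_mul_Iic hsum, integral_exp_mul_Ioi (neg_lt_zero.2 hsum),
    intervalIntegral.integral_comp_mul_left _ hdiff.ne', integral_exp]
  have e1 : exp ((a - b) * x) = exp (a * x) * exp (-(b * x)) := by rw [← exp_add]; ring_nf
  have e2 : exp (-(a + b) * x) = exp (-(a * x)) * exp (-(b * x)) := by rw [← exp_add]; ring_nf
  have e3 : exp (-(a * x)) = (exp (a * x))⁻¹ := exp_neg _
  have hE := (exp_pos (a * x)).ne'
  have hsq : a ^ 2 - b ^ 2 = (a + b) * (a - b) := by ring
  rw [e1, e2, e3, hsq]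
  simp only [mul_zero, exp_zero, smul_eq_mul]
  field_simp
  ring

lemma integral_exp_neg_abs_conv {a b : ℝ} (hb : 0 < b) (hab : b < a) (x : ℝ) :
    ∫ u : ℝ, exp (-(a * |x - u|)) * exp (-(b * |u|)) =
      2 * (a * exp (-(b * |x|)) - b * exp (-(a * |x|))) / (a ^ 2 - b ^ 2) := by
  rcases le_total 0 x with hx | hx
  · rw [abs_of_nonneg hx]
    exact integral_exp_neg_abs_conv_of_nonneg hb hab hx
  · rw [abs_of_nonpos hx, ← integral_exp_neg_abs_conv_of_nonneg hb hab (neg_nonneg.2 hx),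
      ← integral_neg_eq_self]
    refine integral_congr_ae (.of_forall fun u => ?_)
    simp only [abs_neg]
    rw [← abs_neg (x - -u)]
    ring_nf

/-- Invariance of the Laplace distribution under the Anděl AR(1) scheme
(equation (10)): if `β ~ Laplace(λ)` and `β'` equals `φ₁β` with probability
`φ₁²` and `φ₁β + η` with probability `1−φ₁²`, where `η ~ Laplace(λ)` is
independent of `β`, then `β' ~ Laplace(λ)`. -/
theorem laplace_invariant_andel_ar1
    (lam φ1 : ℝ) (hlam : 0 < lam) (hφ1pos : 0 < |φ1|) (hφ1 : |φ1| < 1) :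
    ∀ x : ℝ,
      φ1 ^ 2 * ((1 / |φ1|) * laplacePdf lam (x / φ1)) +
        (1 - φ1 ^ 2) *
          (∫ u : ℝ, (1 / |φ1|) * laplacePdf lam ((x - u) / φ1) * laplacePdf lam u) =
        laplacePdf lam x := by
  intro x
  have hab : lam < lam / |φ1| := (lt_div_iff₀ hφ1pos).2 (mul_lt_of_lt_one_right hlam hφ1)
  have hresc (y : ℝ) : lam * |y / φ1| = lam / |φ1| * |y| := by rw [abs_div]; ring
  have hint : (∫ u : ℝ, (1 / |φ1|) * laplacePdf lam ((x - u) / φ1) * laplacePdf lam u) =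
      lam ^ 2 / (4 * |φ1|) *
        ∫ u : ℝ, exp (-(lam / |φ1| * |x - u|)) * exp (-(lam * |u|)) := by
    rw [← integral_const_mul]
    refine integral_congr_ae (.of_forall fun u => ?_)
    simp only [laplacePdf, hresc]
    ring
  rw [hint, integral_exp_neg_abs_conv hlam hab]
  simp only [laplacePdf, hresc]
  rw [← sq_abs φ1]
  generalize exp (-(lam / |φ1| * |x|)) = A
  generalize exp (-(lam * |x|)) = B
  generalize |φ1| = r at *
  have h1 : 1 - r ^ 2 ≠ 0 := by nlinarith
  have hden : (lam / r) ^ 2 - lam ^ 2 = lam ^ 2 * (1 - r ^ 2) / r ^ 2 := by field_simp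
  rw [hden]
  field_simp
  ring
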